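/- arXiv:1609.08679 — 2 statements merged into one kernel-verified Lean document; each statement's English description precedes it below -/
import Mathlib

section
/- Let p ≥ 2 be a natural number and define c, d as in the context. For positive integers m, l the signs of the product c(m)·d(l)·c(m+l) are distributed as follows: (i) if m + l < 2p then c(m)d(l)c(m+l) > 0; (ii) if pa < m < p(a+1) and pb < l < p(b+1), where either a ≥ 1 and b ∈ {0} ∪ {2,3,4,…}, or a = 0 and b = 1, then c(m)d(l)c(m+l) > 0 when m + l < p(a+b+1) and c(m)d(l)c(m+l) < 0 when m + l > p(a+b+1); (iii) if pa < m < p(a+1) and pb < l < p(b+1), where either a = 0 and b ≥ 2, or a ≥ 1 and b = 1, then c(m)d(l)c(m+l) < 0 when m + l < p(a+b+1) and c(m)d(l)c(m+l) > 0 when m + l > p(a+b+1). -/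
noncomputable def c (p k : ℕ) : ℝ :=
  if k = p then 1 / (p : ℝ)
  else (2 * (p : ℝ)^2 * Real.sin (Real.pi * k / p)) /
       (Real.pi * (k : ℝ) * ((p : ℝ)^2 - (k : ℝ)^2))

noncomputable def d (p k : ℕ) : ℝ :=
  if k = p ∨ k = 2 * p then 1 / (p : ℝ)
  else (6 * (p : ℝ)^2 * (k : ℝ) * Real.sin (Real.pi * k / p)) /
       (Real.pi * ((p : ℝ)^2 - (k : ℝ)^2) * (4 * (p : ℝ)^2 - (k : ℝ)^2))

noncomputable def F11 (p m l : ℕ) (t : ℝ) : ℝ :=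
  c p m * d p l * c p (m + l) *
    Real.exp (-2 * ((m : ℝ)^2 + (l : ℝ)^2 + (m : ℝ) * (l : ℝ)) * t)

noncomputable def F12 (p m l : ℕ) (t : ℝ) : ℝ :=
  c p m * c p l * d p (m + l) *
    Real.exp (-2 * ((m : ℝ)^2 + (l : ℝ)^2 + (m : ℝ) * (l : ℝ)) * t)

lemma neg_one_pow_mul_sin_pos {p a k : ℕ} (h₁ : p * a < k) (h₂ : k < p * (a + 1)) :
    0 < (-1 : ℝ) ^ a * Real.sin (Real.pi * k / p) := by
  have hp : (0 : ℝ) < p := by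
    rcases Nat.eq_zero_or_pos p with rfl | h
    · simp at h₂
    · exact_mod_cast h
  have h₁' : (p : ℝ) * a < k := by exact_mod_cast h₁
  have h₂' : (k : ℝ) < p * (a + 1) := by exact_mod_cast h₂
  rw [← Real.sin_sub_nat_mul_pi]
  apply Real.sin_pos_of_pos_of_lt_pi
  · rw [sub_pos, lt_div_iff₀ hp]
    nlinarith [Real.pi_pos]
  · rw [sub_lt_iff_lt_add, div_lt_iff₀ hp]
    nlinarith [Real.pi_pos]

lemma c_pos_of_lt {p k : ℕ} (hk : 1 ≤ k) (hkp : k < p) : 0 < c p k := by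
  have hs : 0 < Real.sin (Real.pi * k / p) := by
    simpa using neg_one_pow_mul_sin_pos (p := p) (a := 0) (k := k) (by omega) (by omega)
  have hk' : (0 : ℝ) < k := by exact_mod_cast hk
  have hkp' : (k : ℝ) < p := by exact_mod_cast hkp
  have hd : 0 < (p : ℝ) ^ 2 - (k : ℝ) ^ 2 := by nlinarith
  have hp : (0 : ℝ) < p := hk'.trans hkp'
  rw [c, if_neg hkp.ne]
  positivity

lemma neg_one_pow_succ_mul_c_pos {p a k : ℕ} (ha : 1 ≤ a) (h₁ : p * a < k)
    (h₂ : k < p * (a + 1)) : 0 < (-1 : ℝ) ^ (a + 1) * c p k := by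
  have hs := neg_one_pow_mul_sin_pos h₁ h₂
  have hpk : p < k := (Nat.le_mul_of_pos_right p ha).trans_lt h₁
  have hp : (0 : ℝ) < p := by
    have : 0 < p := Nat.pos_of_mul_pos_right (Nat.zero_lt_of_lt h₂)
    exact_mod_cast this
  have hpk' : (p : ℝ) < k := by exact_mod_cast hpk
  have hk : (0 : ℝ) < k := hp.trans hpk'
  have hd : 0 < (k : ℝ) ^ 2 - (p : ℝ) ^ 2 := by nlinarith
  have key : (-1 : ℝ) ^ (a + 1) * c p k =
      2 * (p : ℝ) ^ 2 * ((-1 : ℝ) ^ a * Real.sin (Real.pi * k / p)) /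
        (Real.pi * k * ((k : ℝ) ^ 2 - (p : ℝ) ^ 2)) := by
    rw [c, if_neg hpk.ne', ← neg_sub ((k : ℝ) ^ 2), mul_neg, div_neg, pow_succ]
    ring
  rw [key]
  positivity

lemma c_pos_of_lt_two_mul {p k : ℕ} (hk : 1 ≤ k) (hkp : k < 2 * p) : 0 < c p k := by
  rcases lt_trichotomy k p with h | rfl | h
  · exact c_pos_of_lt hk h
  · rw [c, if_pos rfl]
    positivity
  · simpa using neg_one_pow_succ_mul_c_pos (p := p) (a := 1) (k := k) le_rfl
      (by omega) (by omega)

lemma neg_one_pow_mul_d_pos {p b k : ℕ} (hk : 1 ≤ k) (hb : b = 0 ∨ 2 ≤ b) (h₁ : p * b < k)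
    (h₂ : k < p * (b + 1)) : 0 < (-1 : ℝ) ^ b * d p k := by
  have hs := neg_one_pow_mul_sin_pos h₁ h₂
  have hp : 0 < p := Nat.pos_of_mul_pos_right (Nat.zero_lt_of_lt h₂)
  have hp' : (0 : ℝ) < p := by exact_mod_cast hp
  have hk' : (0 : ℝ) < k := by exact_mod_cast hk
  have hkp : k < p ∨ 2 * p < k := by
    rcases hb with rfl | hb
    · left; simpa using h₂
    · right; nlinarith
  have hd : 0 < ((p : ℝ) ^ 2 - (k : ℝ) ^ 2) * (4 * (p : ℝ) ^ 2 - (k : ℝ) ^ 2) := by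
    rcases hkp with h | h
    · have h' : (k : ℝ) < p := by exact_mod_cast h
      apply mul_pos <;> nlinarith
    · have h' : 2 * (p : ℝ) < k := by exact_mod_cast h
      apply mul_pos_of_neg_of_neg <;> nlinarith
  have key : (-1 : ℝ) ^ b * d p k =
      6 * (p : ℝ) ^ 2 * k * ((-1 : ℝ) ^ b * Real.sin (Real.pi * k / p)) /
        (Real.pi * (((p : ℝ) ^ 2 - (k : ℝ) ^ 2) * (4 * (p : ℝ) ^ 2 - (k : ℝ) ^ 2))) := by
    rw [d, if_neg (by omega), ← mul_assoc Real.pi]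
    ring
  rw [key]
  positivity

lemma d_pos_of_lt_two_mul {p k : ℕ} (hk : 1 ≤ k) (hkp : k < 2 * p) : 0 < d p k := by
  rcases lt_trichotomy k p with h | rfl | h
  · simpa using neg_one_pow_mul_d_pos (p := p) (b := 0) hk (Or.inl rfl) (by omega) (by omega)
  · rw [d, if_pos (Or.inl rfl)]
    positivity
  · have hs := neg_one_pow_mul_sin_pos (p := p) (a := 1) (k := k) (by omega) (by omega)
    have hs' : Real.sin (Real.pi * k / p) < 0 := by simpa using hs
    have hp' : (0 : ℝ) < p := by
      have : 0 < p := by omega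
      exact_mod_cast this
    have h₁ : (p : ℝ) < k := by exact_mod_cast h
    have h₂ : (k : ℝ) < 2 * p := by exact_mod_cast hkp
    have hk' : (0 : ℝ) < k := hp'.trans h₁
    have hd₁ : (p : ℝ) ^ 2 - (k : ℝ) ^ 2 < 0 := by nlinarith
    have hd₂ : 0 < 4 * (p : ℝ) ^ 2 - (k : ℝ) ^ 2 := by nlinarith
    rw [d, if_neg (by omega)]
    exact div_pos_of_neg_of_neg (mul_neg_of_pos_of_neg (by positivity) hs')
      (mul_neg_of_neg_of_pos (mul_neg_of_pos_of_neg Real.pi_pos hd₁) hd₂)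

lemma neg_one_pow_add_mul_pos {i j n : ℕ} {x y z : ℝ} (hx : 0 < (-1 : ℝ) ^ i * x)
    (hy : 0 < (-1 : ℝ) ^ j * y) (hz : 0 < (-1 : ℝ) ^ n * z) :
    0 < (-1 : ℝ) ^ (i + j + n) * (x * y * z) := by
  have h := mul_pos (mul_pos hx hy) hz
  rw [pow_add, pow_add]
  linarith

lemma mul_mul_pos_of_even {i j n : ℕ} {x y z : ℝ} (hx : 0 < (-1 : ℝ) ^ i * x)
    (hy : 0 < (-1 : ℝ) ^ j * y) (hz : 0 < (-1 : ℝ) ^ n * z) (h : Even (i + j + n)) :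
    0 < x * y * z := by
  simpa [h.neg_one_pow] using neg_one_pow_add_mul_pos hx hy hz

lemma mul_mul_neg_of_odd {i j n : ℕ} {x y z : ℝ} (hx : 0 < (-1 : ℝ) ^ i * x)
    (hy : 0 < (-1 : ℝ) ^ j * y) (hz : 0 < (-1 : ℝ) ^ n * z) (h : Odd (i + j + n)) :
    x * y * z < 0 := by
  have := neg_one_pow_add_mul_pos hx hy hz
  rw [h.neg_one_pow] at this
  linarith

/-- The sign of `c p k` for `p * a < k < p * (a + 1)`. -/
lemma neg_one_pow_ite_mul_c_pos {p a k : ℕ} (hk : 1 ≤ k) (h₁ : p * a < k)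
    (h₂ : k < p * (a + 1)) : 0 < (-1 : ℝ) ^ (if a = 0 then 0 else a + 1) * c p k := by
  split_ifs with ha
  · subst ha
    simpa using c_pos_of_lt hk (by simpa using h₂)
  · exact neg_one_pow_succ_mul_c_pos (Nat.one_le_iff_ne_zero.mpr ha) h₁ h₂

/-- The sign of `d p k` for `p * b < k < p * (b + 1)`. -/
lemma neg_one_pow_ite_mul_d_pos {p b k : ℕ} (hk : 1 ≤ k) (h₁ : p * b < k)
    (h₂ : k < p * (b + 1)) : 0 < (-1 : ℝ) ^ (if b = 1 then 0 else b) * d p k := by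
  split_ifs with hb
  · subst hb
    simpa using d_pos_of_lt_two_mul hk (by omega)
  · exact neg_one_pow_mul_d_pos hk (by omega) h₁ h₂

theorem cdc_sign_distribution (p : ℕ) (hp : 2 ≤ p) :
    (∀ m l : ℕ, 1 ≤ m → 1 ≤ l → m + l < 2 * p →
      0 < c p m * d p l * c p (m + l)) ∧
    (∀ a b m l : ℕ,
      ((1 ≤ a ∧ (b = 0 ∨ 2 ≤ b)) ∨ (a = 0 ∧ b = 1)) →
      p * a < m → m < p * (a + 1) → p * b < l → l < p * (b + 1) →
      (m + l < p * (a + b + 1) → 0 < c p m * d p l * c p (m + l)) ∧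
      (p * (a + b + 1) < m + l → c p m * d p l * c p (m + l) < 0)) ∧
    (∀ a b m l : ℕ,
      ((a = 0 ∧ 2 ≤ b) ∨ (1 ≤ a ∧ b = 1)) →
      p * a < m → m < p * (a + 1) → p * b < l → l < p * (b + 1) →
      (m + l < p * (a + b + 1) → c p m * d p l * c p (m + l) < 0) ∧
      (p * (a + b + 1) < m + l → 0 < c p m * d p l * c p (m + l))) := by
  refine ⟨fun m l hm hl hml => mul_pos (mul_pos (c_pos_of_lt_two_mul hm (by omega))
    (d_pos_of_lt_two_mul hl (by omega))) (c_pos_of_lt_two_mul (by omega) hml), ?_, ?_⟩ <;>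
  · intro a b m l hab hm₁ hm₂ hl₁ hl₂
    have hc := neg_one_pow_ite_mul_c_pos (Nat.one_le_of_lt hm₁) hm₁ hm₂
    have hd := neg_one_pow_ite_mul_d_pos (Nat.one_le_of_lt hl₁) hl₁ hl₂
    have low : p * (a + b) < m + l := by rw [mul_add]; omega
    have high : m + l < p * (a + b + 1 + 1) := by
      have : p * (a + b + 1 + 1) = p * (a + 1) + p * (b + 1) := by ring
      omega
    constructor <;> intro h <;>
    first
    | refine mul_mul_pos_of_even hc hd
        (neg_one_pow_ite_mul_c_pos (Nat.one_le_of_lt low) low h) ?_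
    | refine mul_mul_neg_of_odd hc hd
        (neg_one_pow_ite_mul_c_pos (Nat.one_le_of_lt low) low h) ?_
    | refine mul_mul_pos_of_even hc hd
        (neg_one_pow_ite_mul_c_pos (Nat.one_le_of_lt low) h high) ?_
    | refine mul_mul_neg_of_odd hc hd
        (neg_one_pow_ite_mul_c_pos (Nat.one_le_of_lt low) h high) ?_
    all_goals
      simp only [Nat.even_iff, Nat.odd_iff]
      split_ifs <;> first | contradiction | omega
end

section
/- Let p ≥ 3 be a natural number and define F₁₁, F₁₂ as in the context. Then for every real t ≥ 0, (1/5)·∑_{m,l ≥ 1, m+l < p} F₁₂(m, p+l; t) + ∑_{a=1}^∞ ∑_{m,l ≥ 1, m+l < p} F₁₁(ap+m, p+l; t) > 0, where the inner sums run over pairs of positive integers (m,l) with m + l < p. -/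
theorem c_of_lt {p m : ℕ} (hmp : m < p) :
    c p m = 2 * Real.sin (Real.pi * (m / p)) /
      (Real.pi * p * ((m / p : ℝ) * (1 - m / p) * (1 + m / p))) := by
  have hp0 : (p : ℝ) ≠ 0 := by exact_mod_cast (by omega : p ≠ 0)
  rw [c, if_neg (by omega), mul_div_assoc Real.pi]
  rcases Nat.eq_zero_or_pos m with rfl | hm
  · simp
  have hm0 : (m : ℝ) ≠ 0 := by exact_mod_cast hm.ne'
  have h : (m : ℝ) < p := by exact_mod_cast hmp
  have h1 : (p : ℝ) - m ≠ 0 := by linarith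
  have h2 : (p : ℝ) + m ≠ 0 := by positivity
  generalize Real.sin _ = s
  have hpi := Real.pi_ne_zero
  have h4 : 1 - (m / p : ℝ) = (p - m) / p := by field_simp
  have h5 : 1 + (m / p : ℝ) = (p + m) / p := by field_simp
  rw [h4, h5, sq_sub_sq]
  field_simp

theorem sin_shift {p : ℕ} (hp : 0 < p) (a m : ℕ) :
    Real.sin (Real.pi * ((a + 1) * p + m : ℕ) / p) =
      -((-1) ^ a * Real.sin (Real.pi * (m / p))) := by
  have hp0 : (p : ℝ) ≠ 0 := by exact_mod_cast hp.ne'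
  have h : Real.pi * ((a + 1) * p + m : ℕ) / p =
      Real.pi * (m / p) + (a + 1 : ℕ) * Real.pi := by
    push_cast; field_simp; ring
  rw [h, Real.sin_add_nat_mul_pi]
  ring

theorem c_shift {p m : ℕ} (hm : 0 < m) (hmp : m < p) (a : ℕ) :
    c p ((a + 1) * p + m) = (-1) ^ a * (2 * Real.sin (Real.pi * (m / p)) /
      (Real.pi * p * ((a + m / p : ℝ) * (a + 1 + m / p) * (a + 2 + m / p)))) := by
  have hp : (0 : ℝ) < p := by exact_mod_cast (by omega : 0 < p)
  have hm0 : (0 : ℝ) < m := by exact_mod_cast hm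
  rw [c, if_neg (by nlinarith), sin_shift (by omega)]
  generalize Real.sin _ = s
  have hpi := Real.pi_ne_zero
  have h1 : (p : ℝ) ^ 2 - ((a + 1) * p + m : ℕ) ^ 2 =
      -(p ^ 2 * ((a + m / p) * (a + 2 + m / p))) := by
    push_cast; field_simp; ring
  have h2 : (((a + 1) * p + m : ℕ) : ℝ) = p * (a + 1 + m / p) := by
    push_cast; field_simp
  rw [h1, h2]
  have hx : (0 : ℝ) < m / p := by positivity
  generalize (m / p : ℝ) = x at *
  field_simp

theorem d_shift {p m : ℕ} (hm : 0 < m) (hmp : m < p) :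
    d p (p + m) = 6 * (1 + m / p) * Real.sin (Real.pi * (m / p)) /
      (Real.pi * p * ((m / p : ℝ) * (2 + m / p) * (1 - m / p) * (3 + m / p))) := by
  have hp : (0 : ℝ) < p := by exact_mod_cast (by omega : 0 < p)
  have hm0 : (0 : ℝ) < m := by exact_mod_cast hm
  have hmp' : (m : ℝ) < p := by exact_mod_cast hmp
  have hs := sin_shift (p := p) (by omega) 0 m
  simp only [zero_add, one_mul, pow_zero] at hs
  rw [d, if_neg (by omega), hs]
  generalize Real.sin _ = s
  have hpi := Real.pi_ne_zero
  have h1 : (p : ℝ) ^ 2 - (p + m : ℕ) ^ 2 = -(p ^ 2 * (m / p * (2 + m / p))) := by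
    push_cast; field_simp; ring
  have h2 : 4 * (p : ℝ) ^ 2 - (p + m : ℕ) ^ 2 = p ^ 2 * ((1 - m / p) * (3 + m / p)) := by
    push_cast; field_simp; ring
  have h3 : ((p + m : ℕ) : ℝ) = p * (1 + m / p) := by
    push_cast; field_simp
  rw [h1, h2, h3]
  have hx : (0 : ℝ) < m / p := by positivity
  have hx1 : (0 : ℝ) < 1 - m / p := by rw [sub_pos, div_lt_one hp]; exact hmp'
  generalize (m / p : ℝ) = x at *
  field_simp

/-- The `a`-dependent factor of `F11 p ((a + 1) * p + m) (p + l) 0`, with `x = m / p` and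
`z = (m + l) / p`. -/
noncomputable def tailFactor (x z : ℝ) (a : ℕ) : ℝ :=
  1 / ((a + x) * (a + 1 + x) * (a + 2 + x) * ((a + 1 + z) * (a + 2 + z) * (a + 3 + z)))

theorem sum_tailFactor_succ_le {x z : ℝ} (hx : 0 < x) (hz : 0 < z) (n : ℕ) :
    ∑ a ∈ Finset.range n, tailFactor x z (a + 1) ≤
      1 / ((2 + z) * (3 + z) * (4 + z)) *
        ((1 / ((1 + x) * (2 + x)) - 1 / ((n + 1 + x) * (n + 2 + x))) / 2) := by
  induction n with
  | zero => simp
  | succ n ih =>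
    rw [Finset.sum_range_succ]
    have hn : (0 : ℝ) ≤ n := n.cast_nonneg
    have h : tailFactor x z (n + 1) ≤ 1 / ((2 + z) * (3 + z) * (4 + z)) *
        (1 / ((n + 1 + x) * (n + 2 + x) * (n + 3 + x))) := by
      rw [tailFactor, ← one_div_mul_one_div, mul_comm]
      push_cast
      gcongr ?_ * ?_
      · gcongr 1 / (?_ * ?_ * ?_) <;> linarith
      · gcongr 1 / (?_ * ?_ * ?_) <;> linarith
    refine (add_le_add ih h).trans_eq ?_
    rw [← mul_add]
    congr 1
    push_cast
    field_simp
    ring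

theorem sum_tailFactor_le {x z : ℝ} (hx : 0 < x) (hx1 : x ≤ 1) (hz : 0 < z) (hz1 : z ≤ 1)
    (n : ℕ) : ∑ a ∈ Finset.range n, tailFactor x z a ≤ 6 / 5 * tailFactor x z 0 := by
  have hnonneg (a : ℕ) : 0 ≤ tailFactor x z a := by unfold tailFactor; positivity
  calc ∑ a ∈ Finset.range n, tailFactor x z a
      ≤ ∑ a ∈ Finset.range (n + 1), tailFactor x z a :=
        Finset.sum_le_sum_of_subset_of_nonneg (Finset.range_mono n.le_succ) fun a _ _ => hnonneg a
    _ = ∑ a ∈ Finset.range n, tailFactor x z (a + 1) + tailFactor x z 0 :=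
        Finset.sum_range_succ' _ _
    _ ≤ 1 / ((2 + z) * (3 + z) * (4 + z)) * (1 / ((1 + x) * (2 + x)) / 2) +
          tailFactor x z 0 := by
        gcongr
        refine (sum_tailFactor_succ_le hx hz n).trans ?_
        gcongr
        exact sub_le_self _ (by positivity)
    _ ≤ 1 / 5 * tailFactor x z 0 + tailFactor x z 0 := by
        refine add_le_add ?_ le_rfl
        unfold tailFactor
        push_cast
        rw [div_div, one_div_mul_one_div, one_div_mul_one_div,
          div_le_div_iff₀ (by positivity) (by positivity)]
        have key : 5 * (x * (1 + z)) ≤ 2 * (4 + z) := by nlinarith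
        have := mul_le_mul_of_nonneg_left key
          (by positivity : 0 ≤ (1 + x) * (2 + x) * ((2 + z) * (3 + z)))
        linarith
    _ = 6 / 5 * tailFactor x z 0 := by ring

theorem tailFactor_zero_mul_le {x y : ℝ} (hx : 0 < x) (hy : 0 < y) (hxy : x + y < 1) :
    (1 + y) / (y * (2 + y) * (1 - y) * (3 + y)) * (6 / 5 * tailFactor x (x + y) 0) ≤
      (x + y) / 5 * (1 / (x * (1 - x) * (1 + x)) * (1 / (y * (1 + y) * (2 + y))) *
        ((1 + (x + y)) /
          ((x + y) * (2 + (x + y)) * (1 - (x + y)) * (3 + (x + y))))) := by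
  have hx1 : 0 < 1 - x := by linarith
  have hy1 : 0 < 1 - y := by linarith
  obtain ⟨z, hz⟩ : ∃ z, z = x + y := ⟨_, rfl⟩
  rw [← hz] at hxy ⊢
  have hz0 : 0 < z := by linarith
  have hz1 : 0 < 1 - z := by linarith
  have key : 6 * ((1 + y) ^ 2 * ((1 - x) * (1 - z))) ≤
      (1 + z) ^ 2 * ((1 - y) * ((3 + y) * (2 + x))) := by
    calc 6 * ((1 + y) ^ 2 * ((1 - x) * (1 - z)))
        ≤ 6 * ((1 + z) ^ 2 * (1 * (1 - y))) := by gcongr <;> linarith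
      _ = (1 + z) ^ 2 * ((1 - y) * (3 * 2)) := by ring
      _ ≤ _ := by gcongr <;> linarith
  have e1 : (1 + y) / (y * (2 + y) * (1 - y) * (3 + y)) * (6 / 5 * tailFactor x z 0) =
      6 * ((1 + y) ^ 2 * ((1 - x) * (1 - z))) /
      (5 * (x * (1 + x) * (2 + x) * (1 - x) * (y * (1 + y) * (2 + y) * (1 - y) * (3 + y)) *
        ((1 + z) * (2 + z) * (3 + z) * (1 - z)))) := by
    rw [tailFactor]
    push_cast
    simp only [zero_add]
    field_simp
  have e2 : z / 5 * (1 / (x * (1 - x) * (1 + x)) * (1 / (y * (1 + y) * (2 + y))) *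
        ((1 + z) / (z * (2 + z) * (1 - z) * (3 + z)))) =
      (1 + z) ^ 2 * ((1 - y) * ((3 + y) * (2 + x))) /
      (5 * (x * (1 + x) * (2 + x) * (1 - x) * (y * (1 + y) * (2 + y) * (1 - y) * (3 + y)) *
        ((1 + z) * (2 + z) * (3 + z) * (1 - z)))) := by
    field_simp
  rw [e1, e2]
  gcongr

/-- The common factor of `F11 p ((a + 1) * p + m) (p + l) 0` and `F12 p m (p + l) 0`. -/
noncomputable def sineFactor (p m l : ℕ) : ℝ :=
  24 * (Real.sin (Real.pi * (m / p)) * Real.sin (Real.pi * (l / p)) *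
    Real.sin (Real.pi * ((m + l : ℕ) / p))) / (Real.pi * p) ^ 3

theorem sineFactor_pos {p m l : ℕ} (hm : 0 < m) (hl : 0 < l) (h : m + l < p) :
    0 < sineFactor p m l := by
  have hp : (0 : ℝ) < p := by exact_mod_cast (by omega : 0 < p)
  have key (k : ℕ) (hk : 0 < k) (hkp : k < p) : 0 < Real.sin (Real.pi * (k / p)) := by
    have hk' : (0 : ℝ) < k := by exact_mod_cast hk
    have : (k / p : ℝ) < 1 := by rw [div_lt_one hp]; exact_mod_cast hkp
    exact Real.sin_pos_of_pos_of_lt_pi (by positivity) (by nlinarith [Real.pi_pos])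
  have h1 := key m hm (by omega)
  have h2 := key l hl (by omega)
  have h3 := key (m + l) (by omega) h
  unfold sineFactor
  positivity

theorem F12_eq {p m l : ℕ} (hm : 0 < m) (hl : 0 < l) (h : m + l < p) (t : ℝ) :
    F12 p m (p + l) t = sineFactor p m l *
      (1 / ((m / p : ℝ) * (1 - m / p) * (1 + m / p)) *
        (1 / ((l / p : ℝ) * (1 + l / p) * (2 + l / p))) *
        ((1 + (m / p + l / p : ℝ)) / ((m / p + l / p : ℝ) * (2 + (m / p + l / p)) *
          (1 - (m / p + l / p)) * (3 + (m / p + l / p))))) *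
      Real.exp (-2 * ((m : ℝ) ^ 2 + (p + l : ℕ) ^ 2 + m * (p + l : ℕ)) * t) := by
  have hc := c_shift hl (by omega : l < p) 0
  simp only [zero_add, one_mul, pow_zero, Nat.cast_zero] at hc
  rw [F12, c_of_lt (by omega : m < p), hc, show m + (p + l) = p + (m + l) by ring,
    d_shift (by omega : 0 < m + l) h, sineFactor,
    show ((m + l : ℕ) / p : ℝ) = m / p + l / p by push_cast; ring]
  congr 1
  generalize (m / p : ℝ) = x
  generalize (l / p : ℝ) = y
  generalize x * (1 - x) * (1 + x) = A
  generalize y * (1 + y) * (2 + y) = B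
  generalize (x + y) * (2 + (x + y)) * (1 - (x + y)) * (3 + (x + y)) = C
  ring

theorem F11_eq {p m l : ℕ} (hm : 0 < m) (hl : 0 < l) (h : m + l < p) (t : ℝ) (a : ℕ) :
    F11 p ((a + 1) * p + m) (p + l) t = -(sineFactor p m l *
      ((1 + l / p : ℝ) / ((l / p : ℝ) * (2 + l / p) * (1 - l / p) * (3 + l / p)) *
        tailFactor (m / p) (m / p + l / p) a) *
      Real.exp (-2 * ((((a + 1) * p + m : ℕ) : ℝ) ^ 2 + (p + l : ℕ) ^ 2 +
        ((a + 1) * p + m : ℕ) * (p + l : ℕ)) * t)) := by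
  rw [F11, c_shift hm (by omega : m < p), d_shift hl (by omega : l < p),
    show (a + 1) * p + m + (p + l) = ((a + 1) + 1) * p + (m + l) by ring,
    c_shift (by omega : 0 < m + l) h, sineFactor, tailFactor,
    show ((m + l : ℕ) / p : ℝ) = m / p + l / p by push_cast; ring, ← neg_mul]
  congr 1
  have hsq : ((-1 : ℝ) ^ a) * (-1) ^ a = 1 := by rw [← mul_pow]; simp
  push_cast
  rw [show (a + 1 + 1 : ℝ) = a + 2 by ring, show (a + 1 + 2 : ℝ) = a + 3 by ring, pow_succ,
    ← one_div_mul_one_div]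
  generalize (m / p : ℝ) = x
  generalize (l / p : ℝ) = y
  generalize (a + x) * (a + 1 + x) * (a + 2 + x) = A
  generalize y * (2 + y) * (1 - y) * (3 + y) = B
  generalize (a + 1 + (x + y)) * (a + 2 + (x + y)) * (a + 3 + (x + y)) = C
  generalize (-1 : ℝ) ^ a = e at hsq ⊢
  linear_combination -(24 * (1 + y) * Real.sin (Real.pi * x) * Real.sin (Real.pi * y) *
    Real.sin (Real.pi * (x + y)) / (Real.pi * p) ^ 3 / A / B / C) * hsq

theorem F12_pos {p m l : ℕ} (hm : 0 < m) (hl : 0 < l) (h : m + l < p) (t : ℝ) :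
    0 < F12 p m (p + l) t := by
  have hp : (0 : ℝ) < p := by exact_mod_cast (by omega : 0 < p)
  have hm' : (0 : ℝ) < m / p := by have : (0 : ℝ) < m := by exact_mod_cast hm
                                   positivity
  have hl' : (0 : ℝ) < l / p := by have : (0 : ℝ) < l := by exact_mod_cast hl
                                   positivity
  have hz : (m / p + l / p : ℝ) < 1 := by
    rw [← add_div, div_lt_one hp]; exact_mod_cast h
  have h1 : (0 : ℝ) < 1 - m / p := by linarith
  have h2 : (0 : ℝ) < 1 - (m / p + l / p) := by linarith
  have := sineFactor_pos hm hl h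
  rw [F12_eq hm hl h]
  positivity

theorem F11_nonpos {p m l : ℕ} (hm : 0 < m) (hl : 0 < l) (h : m + l < p) (t : ℝ) (a : ℕ) :
    F11 p ((a + 1) * p + m) (p + l) t ≤ 0 := by
  have hp : (0 : ℝ) < p := by exact_mod_cast (by omega : 0 < p)
  have h1 : (0 : ℝ) ≤ 1 - l / p := by
    rw [sub_nonneg, div_le_one hp]; exact_mod_cast (by omega : l ≤ p)
  have := sineFactor_pos hm hl h
  rw [F11_eq hm hl h, neg_nonpos, tailFactor]
  positivity

theorem sum_neg_F11_le {p m l : ℕ} (hm : 0 < m) (hl : 0 < l) (h : m + l < p) {t : ℝ}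
    (ht : 0 ≤ t) (n : ℕ) :
    ∑ a ∈ Finset.range n, -F11 p ((a + 1) * p + m) (p + l) t ≤
      (1 - 1 / p) * (1 / 5 * F12 p m (p + l) t) := by
  have hp : (0 : ℝ) < p := by exact_mod_cast (by omega : 0 < p)
  have hm' : (0 : ℝ) < m / p := by have : (0 : ℝ) < m := by exact_mod_cast hm
                                   positivity
  have hl' : (0 : ℝ) < l / p := by have : (0 : ℝ) < l := by exact_mod_cast hl
                                   positivity
  have hz : (m / p + l / p : ℝ) ≤ 1 - 1 / p := by
    rw [le_sub_iff_add_le, ← add_div, ← add_div, div_le_one hp]; exact_mod_cast h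
  have hp' : (0 : ℝ) < 1 / p := by positivity
  have h1 : (0 : ℝ) < 1 - l / p := by linarith
  have hs := sineFactor_pos hm hl h
  have hF := F12_pos hm hl h t
  have hrat := tailFactor_zero_mul_le hm' hl' (by linarith)
  have hsum := sum_tailFactor_le hm' (by linarith) (add_pos hm' hl') (by linarith) n
  set E := Real.exp (-2 * ((m : ℝ) ^ 2 + (p + l : ℕ) ^ 2 + m * (p + l : ℕ)) * t)
  set Q : ℝ := (1 + l / p : ℝ) / ((l / p : ℝ) * (2 + l / p) * (1 - l / p) * (3 + l / p))
  have hQ0 : 0 ≤ Q := by positivity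
  calc ∑ a ∈ Finset.range n, -F11 p ((a + 1) * p + m) (p + l) t
      ≤ ∑ a ∈ Finset.range n,
          sineFactor p m l * (Q * tailFactor (m / p) (m / p + l / p) a) * E := by
        refine Finset.sum_le_sum fun a _ => ?_
        rw [F11_eq hm hl h, neg_neg]
        have hT : 0 ≤ tailFactor (m / p) (m / p + l / p) a := by unfold tailFactor; positivity
        have hma : (m : ℝ) ≤ ((a + 1) * p + m : ℕ) := by exact_mod_cast Nat.le_add_left _ _
        refine mul_le_mul_of_nonneg_left (Real.exp_le_exp.2 ?_) (by positivity)
        refine mul_le_mul_of_nonneg_right ?_ ht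
        refine mul_le_mul_of_nonpos_left ?_ (by norm_num)
        gcongr
    _ = sineFactor p m l * (Q * ∑ a ∈ Finset.range n, tailFactor (m / p) (m / p + l / p) a) *
          E := by
        rw [Finset.mul_sum, Finset.mul_sum, Finset.sum_mul]
    _ ≤ sineFactor p m l * (Q * (6 / 5 * tailFactor (m / p) (m / p + l / p) 0)) * E := by
        gcongr
    _ ≤ (m / p + l / p) * (1 / 5 * F12 p m (p + l) t) := by
        have hcomm (a s b e : ℝ) : s * (a / 5 * b) * e = a * (1 / 5 * (s * b * e)) := by ring
        rw [F12_eq hm hl h, ← hcomm]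
        gcongr
    _ ≤ _ := by gcongr

theorem J12_J11_compensation1 (p : ℕ) (hp : 3 ≤ p) (t : ℝ) (ht : 0 ≤ t) :
    0 < (1 / 5) * (∑ m ∈ Finset.Ico 1 p, ∑ l ∈ Finset.Ico 1 p,
          if m + l < p then F12 p m (p + l) t else 0)
      + ∑' a : ℕ, (∑ m ∈ Finset.Ico 1 p, ∑ l ∈ Finset.Ico 1 p,
          if m + l < p then F11 p ((a + 1) * p + m) (p + l) t else 0) := by
  set S := ∑ m ∈ Finset.Ico 1 p, ∑ l ∈ Finset.Ico 1 p,
    if m + l < p then F12 p m (p + l) t else 0 with hS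
  have hterm : ∀ m ∈ Finset.Ico 1 p, ∀ l ∈ Finset.Ico 1 p,
      0 ≤ if m + l < p then F12 p m (p + l) t else 0 := by
    intro m hm l hl
    rw [Finset.mem_Ico] at hm hl
    split_ifs with h
    exacts [(F12_pos hm.1 hl.1 h t).le, le_rfl]
  have hSpos : 0 < S := by
    have h1 : 1 ∈ Finset.Ico 1 p := by rw [Finset.mem_Ico]; omega
    refine Finset.sum_pos' (fun m hm => Finset.sum_nonneg (hterm m hm)) ⟨1, h1, ?_⟩
    refine Finset.sum_pos' (hterm 1 h1) ⟨1, h1, ?_⟩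
    rw [if_pos (by omega)]
    exact F12_pos one_pos one_pos (by omega) t
  have hbound : ∑' a : ℕ, -(∑ m ∈ Finset.Ico 1 p, ∑ l ∈ Finset.Ico 1 p,
      if m + l < p then F11 p ((a + 1) * p + m) (p + l) t else 0) ≤
        (1 - 1 / p) * (1 / 5 * S) := by
    refine Real.tsum_le_of_sum_range_le (fun a => ?_) fun n => ?_
    · rw [neg_nonneg]
      refine Finset.sum_nonpos fun m hm => Finset.sum_nonpos fun l hl => ?_
      rw [Finset.mem_Ico] at hm hl
      split_ifs with h
      exacts [F11_nonpos hm.1 hl.1 h t a, le_rfl]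
    · simp only [← Finset.sum_neg_distrib]
      rw [Finset.sum_comm, hS, Finset.mul_sum, Finset.mul_sum]
      refine Finset.sum_le_sum fun m hm => ?_
      rw [Finset.sum_comm, Finset.mul_sum, Finset.mul_sum]
      refine Finset.sum_le_sum fun l hl => ?_
      rw [Finset.mem_Ico] at hm hl
      split_ifs with h
      · exact sum_neg_F11_le hm.1 hl.1 h ht n
      · simp
  rw [tsum_neg] at hbound
  have hp' : (0 : ℝ) < 1 / p := by
    have : (0 : ℝ) < p := by exact_mod_cast (by omega : 0 < p)
    positivity
  nlinarith [mul_pos hp' hSpos]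
end
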